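/- Let ℓ, r ≥ 2, k, m ≥ 0, and let 0 ≤ m̃_1, …, m̃_ℓ ≤ r be integers; set m_i := (k−1)r + 1 + m̃_i for i = 1, …, ℓ and assume all m_i ≥ 0. Set c := ((ℓ−1)m + k − 1)r + 1. Then the multi-arrangement (A, μ) in ℂ^ℓ with defining polynomial Q(A,μ) = x_1^{m_1} ⋯ x_ℓ^{m_ℓ} · ∏_{1≤i<j≤ℓ} (x_i^r − x_j^r)^{2m+1} is free with exponents exp(A,μ) = { c + Σ_{i=1}^ℓ m̃_i, c + r, c + 2r, …, c + (ℓ−1)r }. -/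

import Mathlib

open MvPolynomial

noncomputable section

abbrev PolyS (ℓ : ℕ) := MvPolynomial (Fin ℓ) ℂ

/-- Membership in `D(A, μ)` for the multi-arrangement in `ℂ^ℓ` consisting of the
coordinate hyperplanes `ker x_i` with multiplicity `mult0 i` and the hyperplanes
`ker (x_i - ζ x_j)` (for `i < j` and `ζ` an `r`-th root of unity) with
multiplicity `multH`.  (A multiplicity `0` means the hyperplane is absent.) -/
def InDeriv {ℓ : ℕ} (r : ℕ) (mult0 : Fin ℓ → ℕ) (multH : ℕ)
    (θ : Derivation ℂ (PolyS ℓ) (PolyS ℓ)) : Prop :=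
  (∀ i, θ (X i) ∈ Ideal.span {(X i : PolyS ℓ) ^ mult0 i}) ∧
  ∀ i j : Fin ℓ, i < j → ∀ ζ : ℂ, ζ ^ r = 1 →
    θ (X i - C ζ * X j) ∈ Ideal.span {(X i - C ζ * X j : PolyS ℓ) ^ multH}

/-- `θ` is homogeneous of polynomial degree `p`. -/
def IsHomogDeriv {ℓ : ℕ} (θ : Derivation ℂ (PolyS ℓ) (PolyS ℓ)) (p : ℕ) : Prop :=
  ∀ i, (θ (X i)).IsHomogeneous p

/-- The multi-arrangement with derivation-module membership predicate `P` is free with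
exponents `e 0, …, e (ℓ-1)`: there is a basis of the module of derivations consisting
of `ℓ` homogeneous derivations of polynomial degrees `e 0, …, e (ℓ-1)`. -/
def IsFreeWithExponents {ℓ : ℕ} (P : Derivation ℂ (PolyS ℓ) (PolyS ℓ) → Prop)
    (e : Fin ℓ → ℕ) : Prop :=
  ∃ θ : Fin ℓ → Derivation ℂ (PolyS ℓ) (PolyS ℓ),
    (∀ i, P (θ i)) ∧
    LinearIndependent (PolyS ℓ) θ ∧
    (∀ η, P η → η ∈ Submodule.span (PolyS ℓ) (Set.range θ)) ∧
    (∀ i, IsHomogDeriv (θ i) (e i))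

/-- Variant of `IsFreeWithExponents` with the exponents given as integers. -/
def IsFreeWithExponentsZ {ℓ : ℕ} (P : Derivation ℂ (PolyS ℓ) (PolyS ℓ) → Prop)
    (e : Fin ℓ → ℤ) : Prop :=
  ∃ θ : Fin ℓ → Derivation ℂ (PolyS ℓ) (PolyS ℓ),
    (∀ i, P (θ i)) ∧
    LinearIndependent (PolyS ℓ) θ ∧
    (∀ η, P η → η ∈ Submodule.span (PolyS ℓ) (Set.range θ)) ∧
    (∀ i, ∃ p : ℕ, (p : ℤ) = e i ∧ IsHomogDeriv (θ i) p)

namespace Polynomial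

lemma pow_succ_dvd_of_euler {R : Type*} [CommRing R] [IsDomain R] [CharZero R] (y c r : R)
    (hy : y ≠ 0) (hr : r ≠ 0) (m : ℕ) (H : R[X]) (h0 : H.eval y = 0)
    (h : (X - C y) ^ m ∣ C c * H + C r * X * derivative H) :
    (X - C y) ^ (m + 1) ∣ H := by
  have hp : Prime (X - C y) := prime_X_sub_C y
  suffices ∀ a ≤ m, (X - C y) ^ (a + 1) ∣ H from this m le_rfl
  intro a
  induction a with
  | zero => intro _; simpa [dvd_iff_isRoot] using h0
  | succ a ih =>
    intro ha
    have h1 := ih (by omega)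
    have h2 : (X - C y) ^ (a + 1) ∣ (C r * X) * derivative H := by
      have := (pow_dvd_pow (X - C y) ha).trans h
      exact (dvd_add_right (h1.mul_left (C c))).1 this
    have h3 : (X - C y) ^ (a + 1) ∣ derivative H := by
      refine hp.pow_dvd_of_dvd_mul_left _ ?_ h2
      rw [dvd_iff_isRoot]
      simp [hr, hy]
    obtain ⟨q, rfl⟩ := h1
    have h4 : derivative ((X - C y) ^ (a + 1) * q) =
        (X - C y) ^ a * (C ((a : R) + 1) * q) + (X - C y) ^ (a + 1) * derivative q := by
      simp [derivative_mul, derivative_pow]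
      ring
    rw [h4] at h3
    have h5 := (dvd_add_left (Dvd.intro _ rfl)).1 h3
    rw [pow_succ, mul_dvd_mul_iff_left (pow_ne_zero _ hp.ne_zero)] at h5
    have h6 : (X - C y) ∣ q := by
      refine (hp.dvd_or_dvd h5).resolve_left ?_
      rw [dvd_iff_isRoot]
      simp only [IsRoot, eval_C]
      exact_mod_cast Nat.succ_ne_zero a
    rw [pow_succ]
    exact mul_dvd_mul_left _ h6

lemma dvd_eval_of_dvd_coeff_mul_pow {R : Type*} [CommRing R] (d e : R) (z : R[X])
    (h : ∀ q, e ∣ z.coeff q * d ^ q) : e ∣ z.eval d := by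
  rw [eval_eq_sum, Polynomial.sum]
  exact Finset.dvd_sum fun q _ => h q

lemma pow_dvd_coeff_mul_pow_of_dvd_comp {R : Type*} [CommRing R] (d e : R) (z : R[X])
    (h : C e ∣ z.comp (C d * X)) (q : ℕ) : e ∣ z.coeff q * d ^ q := by
  rw [C_dvd_iff_dvd_coeff] at h
  simpa [comp_C_mul_X_coeff] using h q

lemma sub_pow_dvd_of_euler {R : Type*} [CommRing R] [IsDomain R] [Algebra ℂ R] (a b : R)
    (hd : Prime (a - b)) (hb : ¬ (a - b) ∣ b) (m p : ℕ) (W : R[X])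
    (h : ((X - C a) * (X - C b)) ^ m ∣ X * derivative W - C (p : R) * W) :
    (a - b) ^ (2 * m + 1) ∣ b ^ p * W.eval a - a ^ p * W.eval b := by
  set d := a - b with hdef
  set z : R[X] := (C (b ^ p) * W - C (W.eval b) * X ^ p).comp (X + C b) with hz
  have hz0 : z.coeff 0 = 0 := by
    rw [coeff_zero_eq_eval_zero, hz, eval_comp]
    simp only [eval_sub, eval_mul, eval_C, eval_pow, eval_X, eval_add, zero_add]
    ring
  have hzd : z.eval d = b ^ p * W.eval a - a ^ p * W.eval b := by
    rw [hz, eval_comp]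
    simp only [eval_sub, eval_mul, eval_C, eval_pow, eval_X, eval_add, hdef, sub_add_cancel]
    ring
  have hode : (X + C b) * derivative z - C (p : R) * z =
      C (b ^ p) * (X * derivative W - C (p : R) * W).comp (X + C b) := by
    rw [hz, derivative_comp]
    have hX : (X : R[X]) * derivative (X ^ p) = C (p : R) * X ^ p := by
      cases p with
      | zero => simp
      | succ n => simp; ring
    have hX' := congrArg (fun f : R[X] => f.comp (X + C b)) hX
    simp only [mul_comp, X_comp, C_comp, pow_comp] at hX'
    simp only [derivative_sub, derivative_mul, derivative_C, zero_mul, zero_add, sub_comp,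
      mul_comp, C_comp, X_comp, pow_comp, derivative_add, derivative_X, add_zero, one_mul]
    linear_combination (-C (W.eval b)) * hX'
  have hdiv : C (d ^ (2 * m)) ∣
      ((X + C b) * derivative z - C (p : R) * z).comp (C d * X) := by
    rw [hode]
    obtain ⟨B, hB⟩ := h
    rw [hB]
    simp only [mul_comp, pow_comp, sub_comp, X_comp, C_comp, add_comp]
    refine Dvd.dvd.mul_left (Dvd.dvd.mul_right ?_ _) _
    rw [pow_mul, map_pow]
    refine pow_dvd_pow_of_dvd ?_ m
    refine ⟨(X - 1) * X, ?_⟩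
    simp [hdef]
    ring
  have hcoef := pow_dvd_coeff_mul_pow_of_dvd_comp _ _ _ hdiv
  rw [← hzd]
  refine dvd_eval_of_dvd_coeff_mul_pow _ _ _ fun q => ?_
  induction q with
  | zero => simp [hz0]
  | succ q ih =>
    have h1 := mul_dvd_mul_right (hcoef q) d
    have h2 : ((X + C b) * derivative z - C (p : R) * z).coeff q =
        b * ((q : R) + 1) * z.coeff (q + 1) + ((q : R) - p) * z.coeff q := by
      have h3 : (X * derivative z).coeff q = q * z.coeff q := by
        cases q with
        | zero => simp
        | succ n => rw [coeff_X_mul, coeff_derivative]; push_cast; ring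
      rw [add_mul, coeff_sub, coeff_add, h3, coeff_C_mul, coeff_C_mul, coeff_derivative]
      ring
    rw [h2, ← pow_succ] at h1
    have h4 : d ^ (2 * m + 1) ∣ (b * ((q : R) + 1)) * (z.coeff (q + 1) * d ^ (q + 1)) := by
      have h5 := dvd_sub h1 (ih.mul_left (((q : R) - p) * d))
      convert h5 using 1
      ring
    refine hd.pow_dvd_of_dvd_mul_left _ ?_ h4
    intro h6
    rcases hd.dvd_or_dvd h6 with h6 | h6
    · exact hb h6
    · have hu : IsUnit ((q : R) + 1) := by
        have : ((q : R) + 1) = algebraMap ℂ R (q + 1) := by simp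
        rw [this]
        exact (IsUnit.mk0 _ (by exact_mod_cast Nat.succ_ne_zero q)).map _
      exact hd.not_isUnit (isUnit_of_dvd_unit h6 hu)

end Polynomial

lemma isRelPrime_of_eval {ℓ : ℕ} {p q : PolyS ℓ} (hp : Irreducible p) (x : Fin ℓ → ℂ)
    (hpx : eval x p = 0) (hqx : eval x q ≠ 0) : IsRelPrime p q := by
  rw [hp.isRelPrime_iff_not_dvd]
  rintro ⟨w, rfl⟩
  simp [hpx] at hqx

lemma irreducible_X_sub_C_mul_X {ℓ : ℕ} {i j : Fin ℓ} (hij : i ≠ j) (ζ : ℂ) :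
    Irreducible (X i - C ζ * X j : PolyS ℓ) := by
  have hc : (X i - C ζ * X j : PolyS ℓ).coeff (Finsupp.single i 1) = 1 := by
    have : ¬ Finsupp.single j 1 = (Finsupp.single i 1 : Fin ℓ →₀ ℕ) := by
      rw [Finsupp.single_left_inj one_ne_zero]
      exact hij.symm
    simp [coeff_C_mul, coeff_X, this]
  have hh : (X i - C ζ * X j : PolyS ℓ).IsHomogeneous 1 :=
    (isHomogeneous_X _ _).sub (by simpa using (isHomogeneous_C _ ζ).mul (isHomogeneous_X ℂ j))
  refine irreducible_of_totalDegree_eq_one (hh.totalDegree fun h => ?_) fun x hx => ?_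
  · simp [h] at hc
  · exact isUnit_of_dvd_one (hc ▸ hx _)

lemma eval_X_sub_ne_zero {ℓ r : ℕ} (hr : r ≠ 0) {i j : Fin ℓ} {ζ : ℂ} (hζ : ζ ^ r = 1)
    {x : Fin ℓ → ℂ} (h : ‖x i‖ ≠ ‖x j‖) : eval x (X i - C ζ * X j : PolyS ℓ) ≠ 0 := by
  intro h0
  apply h
  simp only [map_sub, eval_X, map_mul, eval_C] at h0
  rw [sub_eq_zero.1 h0, norm_mul, Complex.norm_eq_one_of_pow_eq_one hζ hr, one_mul]

/-- A point on the hyperplane `x_i = c`, generic up to the prescribed coordinate. -/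
def pointOn {ℓ : ℕ} (i : Fin ℓ) (c : ℂ) (s : Fin ℓ) : ℂ :=
  if s = i then c else (s : ℂ) + 1

lemma norm_natCast_add_one (n : ℕ) : ‖(n : ℂ) + 1‖ = n + 1 := by
  exact_mod_cast Complex.norm_natCast (n + 1)

lemma isRelPrime_X_X {ℓ : ℕ} {i j : Fin ℓ} (hij : i ≠ j) :
    IsRelPrime (X i : PolyS ℓ) (X j) := by
  refine isRelPrime_of_eval X_prime.irreducible (pointOn i 0) ?_ ?_
  · simp [pointOn]
  · simpa [pointOn, hij.symm] using Nat.cast_add_one_ne_zero (R := ℂ) (j : ℕ)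

lemma isRelPrime_X_X_sub {ℓ r : ℕ} (hr : r ≠ 0) (s : Fin ℓ) {i j : Fin ℓ} (hij : i ≠ j) {ζ : ℂ}
    (hζ : ζ ^ r = 1) : IsRelPrime (X s : PolyS ℓ) (X i - C ζ * X j) := by
  refine isRelPrime_of_eval X_prime.irreducible (pointOn s 0) ?_ ?_
  · simp [pointOn]
  · apply eval_X_sub_ne_zero hr hζ
    unfold pointOn
    split_ifs with h1 h2 h2
    · exact absurd (h1.trans h2.symm) hij
    · rw [norm_natCast_add_one, norm_zero]; positivity
    · rw [norm_natCast_add_one, norm_zero]; positivity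
    · rw [norm_natCast_add_one, norm_natCast_add_one]
      intro h
      exact hij (Fin.ext (by exact_mod_cast add_right_cancel h))

lemma isRelPrime_X_sub_X_sub {ℓ r : ℕ} (hr : r ≠ 0) {i j i' j' : Fin ℓ} (hij : i < j)
    (hij' : i' < j') {ζ ζ' : ℂ} (hζ : ζ ^ r = 1) (hζ' : ζ' ^ r = 1)
    (hne : ¬ (i = i' ∧ j = j' ∧ ζ = ζ')) :
    IsRelPrime (X i - C ζ * X j : PolyS ℓ) (X i' - C ζ' * X j') := by
  refine isRelPrime_of_eval (irreducible_X_sub_C_mul_X hij.ne ζ)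
    (pointOn i (ζ * ((j : ℂ) + 1))) ?_ ?_
  · simp [pointOn, hij.ne']
  · by_cases hpair : i = i' ∧ j = j'
    · obtain ⟨rfl, rfl⟩ := hpair
      have h1 : ζ - ζ' ≠ 0 := sub_ne_zero.2 fun h => hne ⟨rfl, rfl, h⟩
      have h2 := Nat.cast_add_one_ne_zero (R := ℂ) (j : ℕ)
      simpa [pointOn, hij.ne', ← sub_mul] using ⟨h1, h2⟩
    · apply eval_X_sub_ne_zero hr hζ'
      have hn : ∀ s, ‖pointOn i (ζ * ((j : ℂ) + 1)) s‖ =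
          (((if s = i then j else s : Fin ℓ) : ℕ) : ℝ) + 1 := by
        intro s
        unfold pointOn
        split_ifs
        · rw [norm_mul, Complex.norm_eq_one_of_pow_eq_one hζ hr, one_mul, norm_natCast_add_one]
        · rw [norm_natCast_add_one]
      rw [hn, hn]
      intro h
      have h' : (if i' = i then j else i') = (if j' = i then j else j') :=
        Fin.ext (by exact_mod_cast add_right_cancel h)
      split_ifs at h' with h1 h2 h2
      · exact hij'.ne (h1.trans h2.symm)
      · exact hpair ⟨h1.symm, h'⟩
      · subst h2 h'
        exact lt_asymm hij hij'
      · exact hij'.ne h'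

/-- The index set of the hyperplanes `ker (x_i - ζ x_j)`, `i < j`, stored as `⟨j, i, ζ⟩`. -/
def hyperplaneIndex (ℓ r : ℕ) : Finset (Σ _ : Fin ℓ, Fin ℓ × ℂ) :=
  Finset.univ.sigma fun j => Finset.Iio j ×ˢ Polynomial.nthRootsFinset r (1 : ℂ)

/-- The defining polynomial of the multi-arrangement. -/
def definingPoly {ℓ : ℕ} (r : ℕ) (mi : Fin ℓ → ℕ) (n : ℕ) : PolyS ℓ :=
  (∏ i, X i ^ mi i) *
    ∏ t ∈ hyperplaneIndex ℓ r, (X t.2.1 - C t.2.2 * X t.1) ^ n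

lemma mem_hyperplaneIndex {ℓ r : ℕ} (hr : 0 < r) (t : Σ _ : Fin ℓ, Fin ℓ × ℂ) :
    t ∈ hyperplaneIndex ℓ r ↔ t.2.1 < t.1 ∧ t.2.2 ^ r = 1 := by
  simp [hyperplaneIndex, Polynomial.mem_nthRootsFinset hr]

lemma definingPoly_dvd {ℓ r : ℕ} (hr : 0 < r) (mi : Fin ℓ → ℕ) (n : ℕ) (p : PolyS ℓ)
    (h1 : ∀ i, X i ^ mi i ∣ p)
    (h2 : ∀ i j : Fin ℓ, i < j → ∀ ζ : ℂ, ζ ^ r = 1 → (X i - C ζ * X j) ^ n ∣ p) :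
    definingPoly r mi n ∣ p := by
  refine IsRelPrime.mul_dvd ?_ ?_ ?_
  · refine IsRelPrime.prod_left fun i _ => IsRelPrime.prod_right fun t ht => ?_
    rw [mem_hyperplaneIndex hr] at ht
    exact (isRelPrime_X_X_sub hr.ne' i ht.1.ne ht.2).pow
  · exact Finset.prod_dvd_of_isRelPrime (fun i _ j _ hij => (isRelPrime_X_X hij).pow)
      fun i _ => h1 i
  · refine Finset.prod_dvd_of_isRelPrime (fun t ht u hu htu => IsRelPrime.pow ?_) fun t ht => ?_
    · rw [Finset.mem_coe, mem_hyperplaneIndex hr] at ht hu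
      refine isRelPrime_X_sub_X_sub hr.ne' ht.1 hu.1 ht.2 hu.2 ?_
      rintro ⟨ha, hb, hc⟩
      obtain ⟨t1, t2, t3⟩ := t
      obtain ⟨u1, u2, u3⟩ := u
      simp only at ha hb hc
      subst ha hb hc
      exact htu rfl
    · rw [mem_hyperplaneIndex hr] at ht
      exact h2 _ _ ht.1 _ ht.2

lemma definingPoly_isHomogeneous {ℓ r : ℕ} (hr : 0 < r) (mi : Fin ℓ → ℕ) (n : ℕ) :
    (definingPoly r mi n).IsHomogeneous (∑ j : Fin ℓ, (mi j + (j : ℕ) * r * n)) := by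
  have hcard : (hyperplaneIndex ℓ r).card = ∑ j : Fin ℓ, (j : ℕ) * r := by
    rw [hyperplaneIndex, Finset.card_sigma]
    refine Finset.sum_congr rfl fun j _ => ?_
    rw [Finset.card_product, Fin.card_Iio,
      (Complex.isPrimitiveRoot_exp r hr.ne').card_nthRootsFinset]
  rw [Finset.sum_add_distrib, ← Finset.sum_mul, ← hcard]
  refine IsHomogeneous.mul (IsHomogeneous.prod _ _ _ fun i _ => ?_) ?_
  · simpa using (isHomogeneous_X ℂ i).pow (mi i)
  · rw [← smul_eq_mul, ← Finset.sum_const]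
    refine IsHomogeneous.prod _ _ _ fun t _ => ?_
    have hh : (X t.2.1 - C t.2.2 * X t.1 : PolyS ℓ).IsHomogeneous 1 :=
      (isHomogeneous_X _ _).sub
        (by simpa using (isHomogeneous_C _ t.2.2).mul (isHomogeneous_X ℂ t.1))
    simpa using hh.pow n

/-- The matrix of coefficients of a family of derivations. -/
def coeffMatrix {ℓ : ℕ} (θ : Fin ℓ → Derivation ℂ (PolyS ℓ) (PolyS ℓ)) :
    Matrix (Fin ℓ) (Fin ℓ) (PolyS ℓ) :=
  Matrix.of fun j i => θ j (X i)

lemma dvd_det_of_dvd_col {R n : Type*} [CommRing R] [Fintype n] [DecidableEq n] (A : Matrix n n R)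
    (d : R) (i : n) (h : ∀ j, d ∣ A j i) : d ∣ A.det := by
  choose w hw using h
  have : A = A.updateCol i (d • w) := by
    ext j i'
    by_cases hi : i' = i
    · subst hi; simp [hw]
    · simp [hi]
  rw [this, Matrix.det_updateCol_smul]
  exact Dvd.intro _ rfl

lemma definingPoly_dvd_det {ℓ r : ℕ} (hr : 0 < r) (mi : Fin ℓ → ℕ) (n : ℕ)
    (θ : Fin ℓ → Derivation ℂ (PolyS ℓ) (PolyS ℓ)) (h : ∀ j, InDeriv r mi n (θ j)) :
    definingPoly r mi n ∣ (coeffMatrix θ).det := by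
  refine definingPoly_dvd hr _ _ _ (fun i => ?_) fun i j hij ζ hζ => ?_
  · exact dvd_det_of_dvd_col _ _ i fun j => Ideal.mem_span_singleton.1 ((h j).1 i)
  · rw [← Matrix.det_updateCol_add_smul_self (coeffMatrix θ) hij.ne (-C ζ)]
    refine dvd_det_of_dvd_col _ _ i fun s => ?_
    have := Ideal.mem_span_singleton.1 ((h s).2 i j hij ζ hζ)
    simpa [coeffMatrix, sub_eq_add_neg, ← MvPolynomial.algebraMap_eq,
      MvPolynomial.smul_eq_C_mul] using this

lemma det_coeffMatrix_isHomogeneous {ℓ : ℕ} (θ : Fin ℓ → Derivation ℂ (PolyS ℓ) (PolyS ℓ))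
    (e : Fin ℓ → ℕ) (h : ∀ j, IsHomogDeriv (θ j) (e j)) :
    (coeffMatrix θ).det.IsHomogeneous (∑ j, e j) := by
  rw [Matrix.det_apply]
  refine IsHomogeneous.sum _ _ _ fun σ _ => ?_
  have hp : (∏ i, coeffMatrix θ (σ i) i).IsHomogeneous (∑ j, e j) := by
    rw [← Equiv.sum_comp σ e]
    exact IsHomogeneous.prod _ _ _ fun i _ => h (σ i) i
  rcases Int.units_eq_one_or (Equiv.Perm.sign σ) with hs | hs <;> rw [hs]
  · simpa using hp
  · simpa using hp.neg

lemma derivation_sum_smul_apply {ℓ : ℕ} (g : Fin ℓ → PolyS ℓ)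
    (θ : Fin ℓ → Derivation ℂ (PolyS ℓ) (PolyS ℓ)) (p : PolyS ℓ) :
    (∑ j, g j • θ j) p = ∑ j, g j * θ j p := by
  refine (congrFun
    (map_sum Derivation.coeFnAddMonoidHom (fun j => g j • θ j) Finset.univ) p).trans ?_
  simp [Finset.sum_apply]

/-- Saito's criterion. -/
lemma saito_criterion {ℓ r : ℕ} (hr : 0 < r) (mi : Fin ℓ → ℕ) (n : ℕ)
    (θ : Fin ℓ → Derivation ℂ (PolyS ℓ) (PolyS ℓ)) (e : Fin ℓ → ℕ)
    (hmem : ∀ j, InDeriv r mi n (θ j)) (hhom : ∀ j, IsHomogDeriv (θ j) (e j))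
    (hdet : (coeffMatrix θ).det ≠ 0)
    (hsum : ∑ j, e j = ∑ j : Fin ℓ, (mi j + (j : ℕ) * r * n)) :
    LinearIndependent (PolyS ℓ) θ ∧
      ∀ η, InDeriv r mi n η → η ∈ Submodule.span (PolyS ℓ) (Set.range θ) := by
  constructor
  · rw [Fintype.linearIndependent_iff]
    intro g hg
    by_contra! hne
    refine hdet (Matrix.exists_vecMul_eq_zero_iff.1 ⟨g, fun h => ?_, ?_⟩)
    · obtain ⟨i, hi⟩ := hne
      exact hi (congrFun h i)
    · ext1 i
      have := congrArg (fun D : Derivation ℂ (PolyS ℓ) (PolyS ℓ) => D (X i)) hg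
      simpa [Matrix.vecMul, dotProduct, coeffMatrix, derivation_sum_smul_apply] using this
  · intro η hη
    obtain ⟨w, hw⟩ := definingPoly_dvd_det hr mi n θ hmem
    have hQ0 : definingPoly r mi n ≠ 0 := fun h => hdet (by rw [hw, h, zero_mul])
    have hw0 : w ≠ 0 := fun h => hdet (by rw [hw, h, mul_zero])
    have hdeg := totalDegree_mul_of_isDomain hQ0 hw0
    rw [← hw, (det_coeffMatrix_isHomogeneous θ e hhom).totalDegree hdet, hsum,
      (definingPoly_isHomogeneous hr mi n).totalDegree hQ0] at hdeg
    have hwC := totalDegree_eq_zero_iff_eq_C.1 (Nat.left_eq_add.1 hdeg)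
    set c := w.coeff 0
    have hc0 : c ≠ 0 := fun h => hw0 (by rw [hwC, h, map_zero])
    have hdvd : ∀ j, definingPoly r mi n ∣ (coeffMatrix (Function.update θ j η)).det := by
      refine fun j => definingPoly_dvd_det hr mi n _ fun s => ?_
      rcases eq_or_ne s j with rfl | hs
      · simpa using hη
      · simpa [hs] using hmem s
    choose b hb using hdvd
    have hη' : η = ∑ j, (C c⁻¹ * b j) • θ j := by
      refine derivation_ext fun i => ?_
      have hcr := congrFun
        (Matrix.mulVec_cramer (coeffMatrix θ).transpose fun i => η (X i)) i
      have hrow : ∀ j, (coeffMatrix θ).updateRow j (fun i => η (X i)) =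
          coeffMatrix (Function.update θ j η) := by
        intro j
        ext1 s i
        rcases eq_or_ne s j with rfl | hs
        · simp [coeffMatrix]
        · simp [coeffMatrix, hs]
      simp only [Matrix.mulVec, dotProduct, Matrix.cramer_transpose_apply, hrow, hb,
        Matrix.det_transpose, hw, hwC, Matrix.transpose_apply, Pi.smul_apply, smul_eq_mul] at hcr
      have hcc : (C c⁻¹ * C c : PolyS ℓ) = 1 := by
        rw [← C_mul, inv_mul_cancel₀ hc0, C_1]
      apply mul_left_cancel₀ hQ0
      rw [derivation_sum_smul_apply]
      calc definingPoly r mi n * η (X i)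
          = C c⁻¹ * (definingPoly r mi n * C c * η (X i)) := by
            linear_combination (-(definingPoly r mi n * η (X i))) * hcc
        _ = _ := by
            rw [← hcr, Finset.mul_sum, Finset.mul_sum]
            refine Finset.sum_congr rfl fun j _ => ?_
            simp only [coeffMatrix, Matrix.of_apply]
            ring
    rw [hη']
    exact Submodule.sum_mem _ fun j _ =>
      Submodule.smul_mem _ _ (Submodule.subset_span ⟨j, rfl⟩)

namespace Polynomial

/-- The preimage of `f` under the operator multiplying the coefficient of `X ^ a` by `e a`. -/
def coeffScaleInv {R : Type*} [CommRing R] [Algebra ℂ R] (e : ℕ → ℂ) (f : R[X]) : R[X] :=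
  ∑ a ∈ Finset.range (f.natDegree + 1), monomial a (algebraMap ℂ R (e a)⁻¹ * f.coeff a)

lemma coeff_coeffScaleInv {R : Type*} [CommRing R] [Algebra ℂ R] (e : ℕ → ℂ) (f : R[X]) (a : ℕ) :
    (coeffScaleInv e f).coeff a = algebraMap ℂ R (e a)⁻¹ * f.coeff a := by
  simp only [coeffScaleInv, finsetSum_coeff, coeff_monomial, Finset.sum_ite_eq',
    Finset.mem_range]
  split_ifs with h
  · rfl
  · rw [coeff_eq_zero_of_natDegree_lt (by omega), mul_zero]

lemma euler_coeffScaleInv {R : Type*} [CommRing R] [Algebra ℂ R] (c r : ℂ)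
    (hne : ∀ a : ℕ, c + r * a ≠ 0) (f : R[X]) :
    C (algebraMap ℂ R c) * coeffScaleInv (fun a => c + r * a) f +
      C (algebraMap ℂ R r) * X * derivative (coeffScaleInv (fun a => c + r * a) f) = f := by
  ext a
  have h1 : (C (algebraMap ℂ R r) * X *
      derivative (coeffScaleInv (fun a => c + r * a) f)).coeff a =
      algebraMap ℂ R (r * a) * (coeffScaleInv (fun a => c + r * a) f).coeff a := by
    rw [mul_assoc, coeff_C_mul]
    cases a with
    | zero => simp
    | succ n =>
      rw [coeff_X_mul, coeff_derivative, map_mul, map_natCast]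
      push_cast
      ring
  rw [coeff_add, h1, coeff_C_mul, ← add_mul, ← map_add, coeff_coeffScaleInv, ← mul_assoc,
    ← map_mul, mul_inv_cancel₀ (hne a), map_one, one_mul]

/-- The integrand `u ^ j ∏ (u - y_s) ^ m`. -/
def integrand {R ι : Type*} [CommRing R] [Fintype ι] (y : ι → R) (m j : ℕ) : R[X] :=
  X ^ j * ∏ s, (X - C (y s)) ^ m

lemma eval_coeffScaleInv_integrand_dvd {R ι : Type*} [CommRing R] [Algebra ℂ R] [Fintype ι]
    (e : ℕ → ℂ) (y : ι → R) (m j : ℕ) (i : ι) :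
    y i ^ (m + j) ∣ (coeffScaleInv e (integrand y m j)).eval (y i) := by
  classical
  refine dvd_eval_of_dvd_coeff_mul_pow _ _ _ fun q => ?_
  rw [coeff_coeffScaleInv, mul_assoc]
  refine Dvd.dvd.mul_left (pow_dvd_coeff_mul_pow_of_dvd_comp _ _ _ ?_ q) _
  rw [integrand, ← Finset.mul_prod_erase _ _ (Finset.mem_univ i)]
  simp only [mul_comp, pow_comp, X_comp, sub_comp, C_comp]
  refine ⟨X ^ j * ((X - 1) ^ m * (∏ s ∈ Finset.univ.erase i, (X - C (y s)) ^ m).comp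
    (C (y i) * X)), ?_⟩
  have h : C (y i) * X - C (y i) = C (y i) * (X - 1) := by ring
  rw [h, map_pow, mul_pow, mul_pow]
  ring

/-- A linear relation between the antiderivatives evaluated at the points `y i` is trivial. -/
lemma eq_zero_of_sum_mul_eval_coeffScaleInv {R : Type*} {ℓ : ℕ} [CommRing R] [IsDomain R]
    [Algebra ℂ R] [CharZero R] [DecompositionMonoid R[X]] (c r : ℂ)
    (hne : ∀ a : ℕ, c + r * a ≠ 0) (hr : r ≠ 0)
    (y : Fin ℓ → R) (hy : ∀ i, y i ≠ 0) (hinj : Function.Injective y) (m : ℕ) (v : Fin ℓ → R)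
    (h : ∀ i, ∑ j : Fin ℓ, v j *
      (coeffScaleInv (fun a => c + r * a) (integrand y m j)).eval (y i) = 0) : v = 0 := by
  set e : ℕ → ℂ := fun a => c + r * a
  set P : R[X] := ∑ j : Fin ℓ, C (v j) * X ^ (j : ℕ) with hP
  have hPdeg : P.degree < ℓ := degree_sum_fin_lt v
  set f : R[X] := P * ∏ s, (X - C (y s)) ^ m with hf
  have hsum : f = ∑ j : Fin ℓ, C (v j) * integrand y m j := by
    rw [hf, hP, Finset.sum_mul]
    simp only [integrand, mul_assoc]
  have hH : coeffScaleInv e f = ∑ j : Fin ℓ, C (v j) * coeffScaleInv e (integrand y m j) := by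
    ext a
    rw [coeff_coeffScaleInv, hsum, finsetSum_coeff, finsetSum_coeff, Finset.mul_sum]
    refine Finset.sum_congr rfl fun j _ => ?_
    rw [coeff_C_mul, coeff_C_mul, coeff_coeffScaleInv]
    ring
  have hr' : algebraMap ℂ R r ≠ 0 := by
    simpa using hr
  have hdvd : ∀ i, (X - C (y i)) ^ (m + 1) ∣ coeffScaleInv e f := by
    intro i
    refine pow_succ_dvd_of_euler (y i) (algebraMap ℂ R c) (algebraMap ℂ R r) (hy i) hr' m _ ?_ ?_
    · rw [hH, eval_finsetSum, ← h i]
      simp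
    · rw [euler_coeffScaleInv c r hne, hf]
      exact (Finset.dvd_prod_of_mem (fun s => (X - C (y s)) ^ m) (Finset.mem_univ i)).mul_left _
  have hprod : ∏ i, (X - C (y i)) ^ (m + 1) ∣ coeffScaleInv e f := by
    refine Finset.prod_dvd_of_isRelPrime (fun i _ j _ hij => IsRelPrime.pow ?_) fun i _ => hdvd i
    rw [(prime_X_sub_C (y i)).irreducible.isRelPrime_iff_not_dvd, dvd_iff_isRoot]
    simpa [sub_eq_zero] using fun h => hij (hinj h)
  have hmonic : (∏ i, (X - C (y i)) ^ m).Monic :=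
    monic_prod_of_monic _ _ fun i _ => (monic_X_sub_C _).pow _
  have hdeg : ∀ n : ℕ, (∏ i, (X - C (y i)) ^ n).degree = ((ℓ * n : ℕ) : WithBot ℕ) := by
    intro n
    rw [degree_prod]
    simp
  have hfdeg : f.degree < ((ℓ * (m + 1) : ℕ) : WithBot ℕ) := by
    rw [hf, degree_mul, hdeg m]
    have : ((ℓ * (m + 1) : ℕ) : WithBot ℕ) = (ℓ : WithBot ℕ) + ((ℓ * m : ℕ) : WithBot ℕ) := by
      norm_cast
      ring
    rw [this]
    exact WithBot.add_lt_add_right (WithBot.coe_ne_bot) hPdeg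
  have hH0 : coeffScaleInv e f = 0 := by
    refine eq_zero_of_dvd_of_degree_lt hprod ?_
    rw [hdeg]
    refine lt_of_le_of_lt ?_ hfdeg
    rw [degree_le_iff_coeff_zero]
    intro a ha
    rw [coeff_coeffScaleInv, coeff_eq_zero_of_degree_lt ha, mul_zero]
  have hf0 : f = 0 := by
    rw [← euler_coeffScaleInv c r hne f, hH0]
    simp
  have hP0 : P = 0 := (mul_eq_zero.1 hf0).resolve_right hmonic.ne_zero
  ext j
  have := congrArg (fun p : R[X] => p.coeff j) hP0
  simpa [hP, finsetSum_coeff, coeff_X_pow, Fin.val_inj] using this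

end Polynomial

/-- Evaluating `f` at an element of degree `r` gives a homogeneous polynomial of degree `N`, term
by term. -/
def IsHomogeneousAlong {ℓ : ℕ} (r : ℕ) (i : Fin ℓ) (N : ℕ) (f : Polynomial (PolyS ℓ)) : Prop :=
  ∀ a, (f.coeff a * (X i ^ r) ^ a).IsHomogeneous N

namespace IsHomogeneousAlong

variable {ℓ r : ℕ} {i : Fin ℓ}

lemma mul {N N' : ℕ} {f g : Polynomial (PolyS ℓ)} (hf : IsHomogeneousAlong r i N f)
    (hg : IsHomogeneousAlong r i N' g) : IsHomogeneousAlong r i (N + N') (f * g) := by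
  intro a
  rw [Polynomial.coeff_mul, Finset.sum_mul]
  refine IsHomogeneous.sum _ _ _ fun p hp => ?_
  have h := (hf p.1).mul (hg p.2)
  rw [← Finset.HasAntidiagonal.mem_antidiagonal.1 hp, pow_add]
  convert h using 1
  ring

lemma one : IsHomogeneousAlong r i 0 1 := by
  intro a
  rw [Polynomial.coeff_one]
  split_ifs with h
  · subst h
    simpa using isHomogeneous_one (Fin ℓ) ℂ
  · simpa using isHomogeneous_zero (Fin ℓ) ℂ 0

lemma pow {N : ℕ} {f : Polynomial (PolyS ℓ)} (hf : IsHomogeneousAlong r i N f) (n : ℕ) :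
    IsHomogeneousAlong r i (n * N) (f ^ n) := by
  induction n with
  | zero => simpa using one
  | succ n ih =>
    rw [pow_succ, add_mul, one_mul]
    exact ih.mul hf

lemma prod {ι : Type*} {s : Finset ι} {N : ℕ} {f : ι → Polynomial (PolyS ℓ)}
    (hf : ∀ t ∈ s, IsHomogeneousAlong r i N (f t)) :
    IsHomogeneousAlong r i (s.card * N) (∏ t ∈ s, f t) := by
  classical
  induction s using Finset.induction_on with
  | empty => simpa using one
  | insert a s ha ih =>
    rw [Finset.prod_insert ha, Finset.card_insert_of_notMem ha, add_mul, one_mul, add_comm]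
    exact (hf _ (Finset.mem_insert_self _ _)).mul
      (ih fun t ht => hf t (Finset.mem_insert_of_mem ht))

lemma X_pow_isHomogeneous (s : Fin ℓ) : (X s ^ r : PolyS ℓ).IsHomogeneous r := by
  simpa using (isHomogeneous_X ℂ s).pow r

lemma polynomial_X : IsHomogeneousAlong r i r Polynomial.X := by
  intro a
  rw [Polynomial.coeff_X]
  split_ifs with h
  · subst h
    simpa using X_pow_isHomogeneous i
  · simpa using isHomogeneous_zero (Fin ℓ) ℂ r

lemma X_sub_C (s : Fin ℓ) :
    IsHomogeneousAlong r i r (Polynomial.X - Polynomial.C (X s ^ r)) := by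
  intro a
  rw [Polynomial.coeff_sub, sub_mul]
  refine (polynomial_X a).sub ?_
  rw [Polynomial.coeff_C]
  split_ifs with h
  · subst h
    simpa using X_pow_isHomogeneous s
  · simpa using isHomogeneous_zero (Fin ℓ) ℂ r

lemma integrand (m j : ℕ) :
    IsHomogeneousAlong r i (j * r + ℓ * (m * r))
      (Polynomial.integrand (fun s : Fin ℓ => (X s ^ r : PolyS ℓ)) m j) := by
  refine (polynomial_X.pow j).mul ?_
  have := prod (s := Finset.univ) fun s _ => (X_sub_C (r := r) (i := i) s).pow m
  simpa using this

lemma eval_coeffScaleInv {N : ℕ} {f : Polynomial (PolyS ℓ)} (hf : IsHomogeneousAlong r i N f)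
    (e : ℕ → ℂ) : ((Polynomial.coeffScaleInv e f).eval (X i ^ r)).IsHomogeneous N := by
  rw [Polynomial.eval_eq_sum, Polynomial.sum]
  refine IsHomogeneous.sum _ _ _ fun a _ => ?_
  rw [Polynomial.coeff_coeffScaleInv, mul_assoc, MvPolynomial.algebraMap_eq]
  simpa using (isHomogeneous_C (Fin ℓ) (e a)⁻¹).mul (hf a)

end IsHomogeneousAlong

lemma isHomogeneous_of_X_pow_mul {ℓ : ℕ} (i : Fin ℓ) (n N : ℕ) (g : PolyS ℓ)
    (h : (X i ^ n * g).IsHomogeneous (n + N)) : g.IsHomogeneous N := by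
  intro d hd
  have h1 : (X i ^ n * g).coeff (Finsupp.single i n + d) ≠ 0 := by
    rw [X_pow_eq_monomial, coeff_monomial_mul, one_mul]
    exact hd
  have h2 := h h1
  rw [map_add, Finsupp.weight_single] at h2
  simpa using h2

lemma exists_antiderivative_quotient {ℓ : ℕ} (r m j : ℕ) (i : Fin ℓ) (e : ℕ → ℂ) :
    ∃ g : PolyS ℓ, g.IsHomogeneous (r * (ℓ - 1) * m) ∧
      (Polynomial.coeffScaleInv e
        (Polynomial.integrand (fun s : Fin ℓ => (X s ^ r : PolyS ℓ)) m j)).eval (X i ^ r) =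
          (X i ^ r) ^ (m + j) * g := by
  obtain ⟨g, hg⟩ := Polynomial.eval_coeffScaleInv_integrand_dvd e
    (fun s : Fin ℓ => (X s ^ r : PolyS ℓ)) m j i
  refine ⟨g, ?_, hg⟩
  have h := (IsHomogeneousAlong.integrand (r := r) (i := i) m j).eval_coeffScaleInv e
  rw [hg, ← pow_mul] at h
  refine isHomogeneous_of_X_pow_mul i (r * (m + j)) _ g ?_
  convert h using 1
  obtain ⟨n, rfl⟩ : ∃ n, ℓ = n + 1 := ⟨ℓ - 1, by have := i.2; omega⟩
  simp only [Nat.add_sub_cancel]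
  ring

lemma euler_eigenvalue_ne_zero {r : ℕ} (hr : 2 ≤ r) (k m a : ℕ) :
    (((k : ℂ) - 1 - m) * r + 1) + r * a ≠ 0 := by
  intro h
  have h1 : ((k : ℤ) - 1 - m + a) * r = -1 := by
    have h2 : (((((k : ℤ) - 1 - m + a) * r : ℤ)) : ℂ) = ((-1 : ℤ) : ℂ) := by
      push_cast
      linear_combination h
    exact_mod_cast h2
  have h3 : (r : ℤ) ∣ 1 := by
    rw [← dvd_neg]
    exact Dvd.intro_left _ h1
  have := Int.le_of_dvd one_pos h3
  omega

/-- The polynomials `H_j` with `x_i ^ ((k - 1 - m) r + 1) H_j(x_i ^ r)` an antiderivative of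
`t ^ ((k - 1 + j - m) r) ∏ (t ^ r - x_s ^ r) ^ m` evaluated at `x_i`. -/
def antiderivative (ℓ r k m j : ℕ) : Polynomial (PolyS ℓ) :=
  Polynomial.coeffScaleInv (fun a => (((k : ℂ) - 1 - m) * r + 1) + r * a)
    (Polynomial.integrand (fun s : Fin ℓ => (X s ^ r : PolyS ℓ)) m j)

namespace Polynomial

lemma euler_expand_antiderivative {ℓ r : ℕ} (hr : 2 ≤ r) (k m j : ℕ) :
    X * derivative (X ^ (k * r + 1) * expand (PolyS ℓ) r (antiderivative ℓ r k m j)) -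
      Polynomial.C ((r * (m + 1) : ℕ) : PolyS ℓ) *
        (X ^ (k * r + 1) * expand (PolyS ℓ) r (antiderivative ℓ r k m j)) =
      X ^ (k * r + 1) * expand (PolyS ℓ) r
        (integrand (fun s : Fin ℓ => (MvPolynomial.X s ^ r : PolyS ℓ)) m j) := by
  have h := congrArg (expand (PolyS ℓ) r) (euler_coeffScaleInv (R := PolyS ℓ) _ _
    (euler_eigenvalue_ne_zero hr k m)
    (integrand (fun s : Fin ℓ => (MvPolynomial.X s ^ r : PolyS ℓ)) m j))
  change expand (PolyS ℓ) r (_ * antiderivative ℓ r k m j +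
    _ * derivative (antiderivative ℓ r k m j)) = _ at h
  rw [← h]
  have hX : (Polynomial.X : (PolyS ℓ)[X]) ^ r = X * X ^ (r - 1) := by
    rw [← pow_succ', Nat.sub_add_cancel (by omega)]
  simp only [map_add, map_mul, expand_X, derivative_mul, derivative_X_pow,
    derivative_expand, map_sub, map_one, map_natCast, hX]
  push_cast
  ring

lemma sub_pow_dvd_antiderivative {ℓ r : ℕ} (hr : 2 ≤ r) (k m t : ℕ) {i j : Fin ℓ} (hij : i ≠ j)
    {ζ : ℂ} (hζ : ζ ^ r = 1) :
    (MvPolynomial.X i - MvPolynomial.C ζ * MvPolynomial.X j : PolyS ℓ) ^ (2 * m + 1) ∣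
      MvPolynomial.X j ^ (r * (m + 1)) * (MvPolynomial.X i ^ (k * r + 1) *
          (antiderivative ℓ r k m t).eval (MvPolynomial.X i ^ r)) -
        MvPolynomial.X i ^ (r * (m + 1)) * (MvPolynomial.C ζ * MvPolynomial.X j ^ (k * r + 1) *
          (antiderivative ℓ r k m t).eval (MvPolynomial.X j ^ r)) := by
  have hζC : (MvPolynomial.C ζ : PolyS ℓ) ^ r = 1 := by rw [← map_pow, hζ, map_one]
  have hb : (MvPolynomial.C ζ * MvPolynomial.X j : PolyS ℓ) ^ r = MvPolynomial.X j ^ r := by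
    rw [mul_pow, hζC, one_mul]
  have hζ0 : ζ ≠ 0 := by
    rintro rfl
    rw [zero_pow (by omega)] at hζ
    exact zero_ne_one hζ
  have hirr := irreducible_X_sub_C_mul_X hij ζ
  have hrel := isRelPrime_X_X_sub (by omega) j hij hζ
  have hdiv := sub_pow_dvd_of_euler (MvPolynomial.X i : PolyS ℓ)
    (MvPolynomial.C ζ * MvPolynomial.X j) hirr.prime ?_ m (r * (m + 1))
    (X ^ (k * r + 1) * expand (PolyS ℓ) r (antiderivative ℓ r k m t)) ?_
  · simp only [eval_mul, eval_pow, eval_X, expand_eval, hb] at hdiv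
    convert hdiv using 2
    · rw [pow_mul (MvPolynomial.C ζ * MvPolynomial.X j), hb, ← pow_mul]
    · rw [mul_pow, pow_succ (MvPolynomial.C ζ : PolyS ℓ), mul_comm k r,
        pow_mul (MvPolynomial.C ζ : PolyS ℓ), hζC, one_pow, one_mul]
  · intro h
    have h1 : (MvPolynomial.X i - MvPolynomial.C ζ * MvPolynomial.X j : PolyS ℓ) ∣
        MvPolynomial.X j := by
      refine h.trans ⟨MvPolynomial.C ζ⁻¹, ?_⟩
      rw [mul_right_comm, ← map_mul, mul_inv_cancel₀ hζ0, map_one, one_mul]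
    exact hirr.not_isUnit (hrel h1 dvd_rfl)
  · rw [euler_expand_antiderivative hr]
    refine Dvd.dvd.mul_left ?_ _
    rw [integrand, map_mul (expand (PolyS ℓ) r), map_prod (expand (PolyS ℓ) r),
      ← Finset.mul_prod_erase _ _ (Finset.mem_univ i),
      ← Finset.mul_prod_erase _ _ (Finset.mem_erase.2 ⟨hij.symm, Finset.mem_univ j⟩)]
    refine Dvd.dvd.mul_left ?_ _
    rw [← mul_assoc]
    refine Dvd.dvd.mul_right ?_ _
    rw [← hb]
    simp only [map_pow, map_sub, expand_X, expand_C]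
    rw [← mul_pow]
    exact pow_dvd_pow_of_dvd
      (mul_dvd_mul (sub_dvd_pow_sub_pow _ _ r) (sub_dvd_pow_sub_pow _ _ r)) m

end Polynomial

/-- The monomial factor of the `j`-th basis element. -/
def extraFactor {ℓ : ℕ} (mt : Fin ℓ → ℕ) (j : ℕ) : PolyS ℓ :=
  if j = 0 then ∏ s, X s ^ mt s else 1

lemma extraFactor_ne_zero {ℓ : ℕ} (mt : Fin ℓ → ℕ) (j : ℕ) : extraFactor mt j ≠ 0 := by
  unfold extraFactor
  split_ifs
  · exact Finset.prod_ne_zero_iff.2 fun s _ => pow_ne_zero _ (X_ne_zero s)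
  · exact one_ne_zero

lemma X_pow_injective {ℓ r : ℕ} (hr : r ≠ 0) :
    Function.Injective fun s : Fin ℓ => (X s ^ r : PolyS ℓ) := by
  intro s t h
  by_contra hst
  have hdvd : (X s : PolyS ℓ) ∣ X t ^ r := (dvd_pow_self (X s) hr).trans (Eq.dvd h)
  exact X_prime.not_isUnit (isRelPrime_X_X hst dvd_rfl (X_prime.dvd_of_dvd_pow hdvd))

/-- The entries of the coefficient matrix of the basis. -/
lemma exists_entries {ℓ r k m : ℕ} (mt mi : Fin ℓ → ℕ) (hmt : ∀ i, mt i ≤ r)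
    (hmi : ∀ i, (mi i : ℤ) = ((k : ℤ) - 1) * r + 1 + mt i) (j i : Fin ℓ) :
    ∃ p : PolyS ℓ, X i ^ mi i ∣ p ∧
      X i ^ (r * (m + 1)) * p =
        extraFactor mt j * (X i ^ (k * r + 1) * (antiderivative ℓ r k m j).eval (X i ^ r)) ∧
      ∀ n : ℕ, (n : ℤ) = (if (j : ℕ) = 0 then
          ((((ℓ : ℤ) - 1) * m + k - 1) * r + 1) + ∑ s, (mt s : ℤ)
        else ((((ℓ : ℤ) - 1) * m + k - 1) * r + 1) + (j : ℕ) * r) → p.IsHomogeneous n := by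
  obtain ⟨g, hg, hgq⟩ := exists_antiderivative_quotient r m j i
    (fun a => (((k : ℂ) - 1 - m) * r + 1) + r * a)
  change (antiderivative ℓ r k m j).eval (X i ^ r) = _ at hgq
  have hmi' : mi i + r = k * r + 1 + mt i := by
    zify
    rw [hmi]
    ring
  have hℓ : ((ℓ - 1 : ℕ) : ℤ) = ℓ - 1 := by
    have := i.2
    omega
  unfold extraFactor
  rw [hgq]
  split_ifs with hj
  · refine ⟨X i ^ mi i * ((∏ s ∈ Finset.univ.erase i, X s ^ mt s) * g), Dvd.intro _ rfl, ?_, ?_⟩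
    · rw [hj, ← Finset.mul_prod_erase _ _ (Finset.mem_univ i)]
      calc _ = X i ^ (mi i + r) * (X i ^ (r * m) *
            ((∏ s ∈ Finset.univ.erase i, X s ^ mt s) * g)) := by ring
        _ = _ := by rw [hmi']; ring
    · intro n hn
      have hX : ∀ (s : Fin ℓ) (q : ℕ), (X s ^ q : PolyS ℓ).IsHomogeneous q := fun s q => by
        simpa using (isHomogeneous_X ℂ s).pow q
      have h := (hX i (mi i)).mul ((IsHomogeneous.prod (Finset.univ.erase i) _ _
        fun s _ => hX s (mt s)).mul hg)
      convert h using 1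
      rw [← Finset.add_sum_erase _ _ (Finset.mem_univ i)] at hn
      zify
      rw [hn, hmi, hℓ]
      ring
  · obtain ⟨q, hq⟩ := Nat.exists_eq_succ_of_ne_zero hj
    refine ⟨X i ^ ((k + q) * r + 1) * g, Dvd.dvd.mul_right (pow_dvd_pow _ ?_) _, ?_, ?_⟩
    · have := hmt i
      nlinarith
    · rw [hq, Nat.succ_eq_add_one]
      ring
    · intro n hn
      have h := ((isHomogeneous_X ℂ i).pow ((k + q) * r + 1)).mul hg
      convert h using 1
      zify
      rw [hn, hℓ, hq]
      push_cast
      ring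

lemma sum_exponents_eq {ℓ r k m : ℕ} (hℓ : 2 ≤ ℓ) (mt mi e : Fin ℓ → ℕ)
    (hmi : ∀ i, (mi i : ℤ) = ((k : ℤ) - 1) * r + 1 + mt i)
    (he : ∀ j, (e j : ℤ) = (if (j : ℕ) = 0 then
          ((((ℓ : ℤ) - 1) * m + k - 1) * r + 1) + ∑ s, (mt s : ℤ)
        else ((((ℓ : ℤ) - 1) * m + k - 1) * r + 1) + (j : ℕ) * r)) :
    ∑ j, e j = ∑ j : Fin ℓ, (mi j + (j : ℕ) * r * (2 * m + 1)) := by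
  obtain ⟨n, rfl⟩ : ∃ n, ℓ = n + 1 := ⟨ℓ - 1, by omega⟩
  have he' : ∀ j, (e j : ℤ) = ((((n + 1 : ℕ) : ℤ) - 1) * m + k - 1) * r + 1 + (j : ℕ) * r +
      (if j = 0 then ∑ s, (mt s : ℤ) else 0) := by
    intro j
    rw [he]
    by_cases hj : j = 0
    · subst hj
      simp
    · have : ¬ (j : ℕ) = 0 := fun h => hj (Fin.ext h)
      simp [hj, this]
  have hgauss : (∑ j : Fin (n + 1), ((j : ℕ) : ℤ)) * 2 = (n + 1) * n := by
    rw [Fin.sum_univ_eq_sum_range (fun j => (j : ℤ)) (n + 1)]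
    have h := Finset.sum_range_id_mul_two (n + 1)
    rw [Nat.add_sub_cancel] at h
    zify at h
    exact h
  zify
  simp only [he', hmi, Finset.sum_add_distrib, ← Finset.sum_mul, Finset.sum_const,
    Finset.card_univ, Fintype.card_fin, Finset.sum_ite_eq', Finset.mem_univ, if_true, nsmul_eq_mul]
  push_cast
  linear_combination (-(r : ℤ) * m) * hgauss

lemma exists_nat_exponent {ℓ r k m : ℕ} (hℓ : 2 ≤ ℓ) (mt mi : Fin ℓ → ℕ)
    (hmi : ∀ i, (mi i : ℤ) = ((k : ℤ) - 1) * r + 1 + mt i) (j : Fin ℓ) :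
    ∃ n : ℕ, (n : ℤ) = (if (j : ℕ) = 0 then
          ((((ℓ : ℤ) - 1) * m + k - 1) * r + 1) + ∑ s, (mt s : ℤ)
        else ((((ℓ : ℤ) - 1) * m + k - 1) * r + 1) + (j : ℕ) * r) := by
  suffices h : 0 ≤ (if (j : ℕ) = 0 then
          ((((ℓ : ℤ) - 1) * m + k - 1) * r + 1) + ∑ s, (mt s : ℤ)
        else ((((ℓ : ℤ) - 1) * m + k - 1) * r + 1) + (j : ℕ) * r) from
    ⟨_, Int.toNat_of_nonneg h⟩
  obtain ⟨n, rfl⟩ : ∃ n, ℓ = n + 1 := ⟨ℓ - 1, by omega⟩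
  have h1 : (0 : ℤ) ≤ n * m * r := by positivity
  split_ifs with hj
  · rw [← Finset.add_sum_erase _ _ (Finset.mem_univ j)]
    have h2 := hmi j
    have h3 : (0 : ℤ) ≤ ∑ s ∈ Finset.univ.erase j, (mt s : ℤ) :=
      Finset.sum_nonneg fun _ _ => by positivity
    push_cast
    linarith
  · obtain ⟨q, hq⟩ := Nat.exists_eq_succ_of_ne_zero hj
    rw [hq]
    have h2 : (0 : ℤ) ≤ (k + q) * r := by positivity
    push_cast
    linarith

lemma inDeriv_mkDerivation {ℓ r k m : ℕ} (hr : 2 ≤ r) (mt mi : Fin ℓ → ℕ) (t : ℕ)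
    (p : Fin ℓ → PolyS ℓ) (hdvd : ∀ i, X i ^ mi i ∣ p i)
    (heq : ∀ i, X i ^ (r * (m + 1)) * p i =
      extraFactor mt t * (X i ^ (k * r + 1) * (antiderivative ℓ r k m t).eval (X i ^ r))) :
    InDeriv r mi (2 * m + 1) (mkDerivation ℂ p) := by
  refine ⟨fun i => ?_, fun i j hij ζ hζ => ?_⟩
  · rw [Ideal.mem_span_singleton, mkDerivation_X]
    exact hdvd i
  · rw [Ideal.mem_span_singleton]
    have hval : mkDerivation ℂ p (X i - C ζ * X j) = p i - C ζ * p j := by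
      simp [mkDerivation_X, Derivation.leibniz]
    rw [hval]
    have hirr := irreducible_X_sub_C_mul_X hij.ne ζ
    have hX : ∀ s : Fin ℓ, ¬ (X i - C ζ * X j : PolyS ℓ) ∣ X s ^ (r * (m + 1)) := by
      intro s h
      exact hirr.not_isUnit
        (isRelPrime_X_X_sub (by omega) s hij.ne hζ (hirr.prime.dvd_of_dvd_pow h) dvd_rfl)
    have h := (Polynomial.sub_pow_dvd_antiderivative hr k m t hij.ne hζ).mul_left (extraFactor mt t)
    refine hirr.prime.pow_dvd_of_dvd_mul_left _ (hX i)
      (hirr.prime.pow_dvd_of_dvd_mul_left _ (hX j) ?_)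
    convert h using 1
    linear_combination (X j ^ (r * (m + 1))) * heq i - X i ^ (r * (m + 1)) * C ζ * heq j

lemma det_ne_zero_of_entries {ℓ r k m : ℕ} (hr : 2 ≤ r) (mt : Fin ℓ → ℕ)
    (p : Matrix (Fin ℓ) (Fin ℓ) (PolyS ℓ))
    (heq : ∀ j i : Fin ℓ, X i ^ (r * (m + 1)) * p j i =
      extraFactor mt j * (X i ^ (k * r + 1) * (antiderivative ℓ r k m j).eval (X i ^ r))) :
    p.det ≠ 0 := by
  intro h
  obtain ⟨v, hv0, hv⟩ := Matrix.exists_vecMul_eq_zero_iff.2 h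
  refine hv0 (funext fun j => ?_)
  have hzero := Polynomial.eq_zero_of_sum_mul_eval_coeffScaleInv _ _
    (euler_eigenvalue_ne_zero hr k m) (by exact_mod_cast (by omega : r ≠ 0))
    (fun s : Fin ℓ => (X s ^ r : PolyS ℓ)) (fun s => pow_ne_zero _ (X_ne_zero s))
    (X_pow_injective (by omega)) m (fun j => v j * extraFactor mt j) fun i => ?_
  · exact (mul_eq_zero.1 (congrFun hzero j)).resolve_right (extraFactor_ne_zero mt j)
  · have h1 := congrArg (fun q => X i ^ (r * (m + 1)) * q) (congrFun hv i)
    simp only [Matrix.vecMul, dotProduct, Pi.zero_apply, mul_zero, Finset.mul_sum] at h1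
    apply mul_left_cancel₀ (pow_ne_zero (k * r + 1) (X_ne_zero (R := ℂ) i))
    rw [mul_zero, ← h1, Finset.mul_sum]
    refine Finset.sum_congr rfl fun j _ => ?_
    change _ * (_ * (antiderivative ℓ r k m j).eval (X i ^ r)) = _
    linear_combination (-v j) * heq j i

theorem stmt12 (ℓ r k m : ℕ) (hℓ : 2 ≤ ℓ) (hr : 2 ≤ r)
    (mt : Fin ℓ → ℕ) (hmt : ∀ i, mt i ≤ r)
    (mi : Fin ℓ → ℕ) (hmi : ∀ i, (mi i : ℤ) = ((k : ℤ) - 1) * r + 1 + mt i) :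
    IsFreeWithExponentsZ (InDeriv r mi (2 * m + 1))
      (fun i =>
        if (i : ℕ) = 0 then
          ((((ℓ : ℤ) - 1) * m + k - 1) * r + 1) + ∑ j, (mt j : ℤ)
        else ((((ℓ : ℤ) - 1) * m + k - 1) * r + 1) + (i : ℕ) * r) := by
  choose p hdvd heq hhom using exists_entries (m := m) mt mi hmt hmi
  choose e he using exists_nat_exponent (m := m) hℓ mt mi hmi
  have hmem : ∀ j, InDeriv r mi (2 * m + 1) (mkDerivation ℂ (p j)) :=
    fun j => inDeriv_mkDerivation hr mt mi j (p j) (hdvd j) (heq j)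
  have hhomog : ∀ j, IsHomogDeriv (mkDerivation ℂ (p j)) (e j) := fun j i => by
    rw [mkDerivation_X]
    exact hhom j i _ (he j)
  have hdet : (coeffMatrix fun j => mkDerivation ℂ (p j)).det ≠ 0 := by
    refine det_ne_zero_of_entries (k := k) (m := m) hr mt _ fun j i => ?_
    rw [coeffMatrix, Matrix.of_apply, mkDerivation_X]
    exact heq j i
  obtain ⟨hli, hspan⟩ := saito_criterion (by omega) mi (2 * m + 1) _ e hmem hhomog hdet
    (sum_exponents_eq hℓ mt mi e hmi he)
  exact ⟨_, hmem, hli, hspan, fun j => ⟨e j, he j, hhomog j⟩⟩
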